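/- Let D be poised Birkhoff interpolation data with (y^0, 0) ∈ D, every α^i belonging to a finite multi-index set A with 0 ∈ A and |α| ≤ 2 for all α ∈ A, and Δ(Y) ≤ Δ. Suppose D is Λ-poised with respect to A in B(y^0, Δ(Y)), let C = C(n, φ) be a constant depending only on n and the natural basis for which Λ-poisedness implies ‖M̂^{-1}‖₂ ≤ CΛ, and let f : R^n → R be twice continuously differentiable with ∇²f Lipschitz with constant L on an open set containing B̄(y^0, 2Δ). Let m be the quadratic Birkhoff interpolant of f for the data D, with Hessian H, and set n_ℓ = #{i : |α^i| = ℓ}. Then for all y ∈ B̄(y^0, Δ): ‖∇²m(y) − ∇²f(y)‖ ≤ √2·((9/4)n_0 + 4n_1 + 4n_2)^{1/2}·L·CΛ·Δ, ‖∇m(y) − ∇f(y)‖ ≤ (1+√2)·((9/4)n_0 + 4n_1 + 4n_2)^{1/2}·L·CΛ·Δ², and |m(y) − f(y)| ≤ (4/3 + 2(1+2√2)·((9/4)n_0 + 4n_1 + 4n_2)^{1/2}·CΛ)·L·Δ³; i.e., m is a fully quadratic model of f on B̄(y^0, Δ). -/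

import Mathlib

noncomputable section

open Metric

/-- `ℝ^n` with the Euclidean norm. -/
abbrev E (n : ℕ) := EuclideanSpace ℝ (Fin n)

/-- Partial derivative in coordinate `i`. -/
def pd {n : ℕ} (i : Fin n) (f : E n → ℝ) : E n → ℝ :=
  fun x => fderiv ℝ f x (EuclideanSpace.single i 1)

/-- Mixed partial derivative `∂^α` associated with the multi-index `α`. -/
def mpd {n : ℕ} (α : Fin n → ℕ) (f : E n → ℝ) : E n → ℝ :=
  (List.finRange n).foldr (fun i g => (pd i)^[α i] g) f

/-- The order `|α|` of a multi-index. -/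
def mdeg {n : ℕ} (α : Fin n → ℕ) : ℕ := ∑ j, α j

/-- Index type for the natural basis of quadratic polynomials in `n` variables:
`1`, the `n` linear monomials, and the quadratic monomials indexed by unordered pairs.
Its cardinality is `q + 1 = (n+1)(n+2)/2`. -/
abbrev BIdx (n : ℕ) := Unit ⊕ Fin n ⊕ Sym2 (Fin n)

/-- The natural basis `1, x_1, …, x_n, (1/2)x_1², x_1x_2, …, (1/2)x_n²` of `P_n^2`. -/
def natBasis {n : ℕ} : BIdx n → E n → ℝ
  | Sum.inl _ => fun _ => 1
  | Sum.inr (Sum.inl i) => fun x => x i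
  | Sum.inr (Sum.inr s) => fun x =>
      Sym2.lift ⟨fun i j => (if i = j then (1:ℝ)/2 else 1) * (x i * x j), by
        intro a b
        by_cases h : a = b
        · subst h; ring
        · simp only [if_neg h, if_neg (Ne.symm h)]; ring⟩ s

/-- The base point `y^0` of interpolation data. -/
def center {n : ℕ} (y : BIdx n → E n) : E n := y (Sum.inl ())

/-- `Δ(Y) = max_i ‖y^i − y^0‖`. -/
def rad {n : ℕ} (y : BIdx n → E n) : ℝ :=
  Finset.univ.sup' Finset.univ_nonempty fun i => ‖y i - center y‖

/-- The normalized points `ŷ^i = (y^i − y^0)/Δ(Y)`. -/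
def yhat {n : ℕ} (y : BIdx n → E n) (i : BIdx n) : E n := (rad y)⁻¹ • (y i - center y)

/-- The normalized interpolation matrix `M̂_{ij} = (∂^{α^i} φ_j)(ŷ^i)`. -/
def Mhat {n : ℕ} (y : BIdx n → E n) (α : BIdx n → Fin n → ℕ) : Matrix (BIdx n) (BIdx n) ℝ :=
  Matrix.of fun i j => mpd (α i) (natBasis j) (yhat y i)

/-- The quadratic polynomial with coefficient vector `v` in the natural basis. -/
def evalP {n : ℕ} (v : BIdx n → ℝ) : E n → ℝ := fun x => ∑ j, v j * natBasis j x

/-- `v` lists the coefficient vectors of the Birkhoff interpolation polynomials: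
`∂^{α^{i'}} λ_i (ŷ^{i'}) = δ_{i i'}`. -/
def BirkhoffLam {n : ℕ} (y : BIdx n → E n) (α : BIdx n → Fin n → ℕ)
    (v : BIdx n → BIdx n → ℝ) : Prop :=
  ∀ i i', mpd (α i') (evalP (v i)) (yhat y i') = if i = i' then 1 else 0

/-- The spectral (ℓ²-operator) norm of a real matrix. -/
def specNorm {ι : Type*} [Fintype ι] [DecidableEq ι] (M : Matrix ι ι ℝ) : ℝ :=
  ‖Matrix.toEuclideanCLM (𝕜 := ℝ) M‖

/-- `q + 1 = (n+1)(n+2)/2`. -/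
def Q1 (n : ℕ) : ℕ := (n + 1) * (n + 2) / 2

/-- The quadratic model `m(y^0 + s) = c + gᵀs + (1/2)sᵀHs`, as a function of `x = y^0 + s`. -/
def quadModel {n : ℕ} (c : ℝ) (g : Fin n → ℝ) (H : Matrix (Fin n) (Fin n) ℝ)
    (y0 : E n) : E n → ℝ :=
  fun x => c + (∑ i, g i * (x i - y0 i)) +
    (1 / 2) * ∑ i, ∑ j, (x i - y0 i) * H i j * (x j - y0 j)

/-- The Hessian matrix of `f` at `x`. -/
def hessMat {n : ℕ} (f : E n → ℝ) (x : E n) : Matrix (Fin n) (Fin n) ℝ :=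
  Matrix.of fun i j =>
    fderiv ℝ (fderiv ℝ f) x (EuclideanSpace.single i 1) (EuclideanSpace.single j 1)

/-- The gradient of `f` at `x` as a vector. -/
def gradVec {n : ℕ} (f : E n → ℝ) (x : E n) : Fin n → ℝ :=
  fun i => fderiv ℝ f x (EuclideanSpace.single i 1)

/-- `n_ℓ`, the number of interpolation conditions of derivative order `ℓ`. -/
def ncount {n : ℕ} (α : BIdx n → Fin n → ℕ) (ℓ : ℕ) : ℕ :=
  (Finset.univ.filter fun i => mdeg (α i) = ℓ).card

/-- `((9/4)n_0 + 4n_1 + 4n_2)^{1/2}`. -/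
def kfac {n : ℕ} (α : BIdx n → Fin n → ℕ) : ℝ :=
  Real.sqrt ((9 / 4) * ncount α 0 + 4 * ncount α 1 + 4 * ncount α 2)


/-! helpers -/
theorem mpd_list {n : ℕ} (α : Fin n → ℕ) : ∃ js : List (Fin n), js.length = mdeg α ∧
    ∀ f : E n → ℝ, mpd α f = js.foldr pd f := by
  have key : ∀ l : List (Fin n), ∃ js : List (Fin n), js.length = (l.map α).sum ∧
      ∀ f : E n → ℝ, l.foldr (fun i g => (pd i)^[α i] g) f = js.foldr pd f := by
    intro l
    induction l with
    | nil => exact ⟨[], rfl, fun f => rfl⟩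
    | cons a l ih =>
      obtain ⟨js, h1, h2⟩ := ih
      refine ⟨List.replicate (α a) a ++ js, by simp [h1], fun f => ?_⟩
      rw [List.foldr_cons, h2, List.foldr_append]
      generalize js.foldr pd f = F
      generalize α a = k
      induction k with
      | zero => rfl
      | succ k ih => rw [Function.iterate_succ_apply', ih, List.replicate_succ, List.foldr_cons]
  obtain ⟨js, h1, h2⟩ := key (List.finRange n)
  refine ⟨js, ?_, h2⟩
  rw [h1, mdeg, ← List.sum_ofFn, List.ofFn_eq_map]

open scoped ContDiff

theorem pd_smooth {n : ℕ} {f : E n → ℝ} (hf : ContDiff ℝ ∞ f) (i : Fin n) :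
    ContDiff ℝ ∞ (pd i f) := by
  unfold pd
  exact (hf.fderiv_right (m := ∞) (by simp)).clm_apply contDiff_const

theorem fold_smooth {n : ℕ} {f : E n → ℝ} (hf : ContDiff ℝ ∞ f) (js : List (Fin n)) :
    ContDiff ℝ ∞ (js.foldr pd f) := by
  induction js with
  | nil => exact hf
  | cons a l ih => exact pd_smooth ih a

theorem smooth_da {n : ℕ} {f : E n → ℝ} (hf : ContDiff ℝ ∞ f) (x : E n) :
    DifferentiableAt ℝ f x := hf.differentiable (by simp) x

theorem fold_sum {n : ℕ} {ι : Type*} [Fintype ι] (φ : ι → E n → ℝ)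
    (hφ : ∀ j, ContDiff ℝ ∞ (φ j)) (w : ι → ℝ) (js : List (Fin n)) :
    js.foldr pd (fun x => ∑ j, w j * φ j x) = fun x => ∑ j, w j * js.foldr pd (φ j) x := by
  induction js with
  | nil => rfl
  | cons a l ih =>
    rw [List.foldr_cons, ih]
    funext x
    simp only [List.foldr_cons]
    have : HasFDerivAt (fun x => ∑ j, w j * l.foldr pd (φ j) x)
        (∑ j, w j • fderiv ℝ (l.foldr pd (φ j)) x) x := by
      apply HasFDerivAt.fun_sum
      intro j _
      exact ((smooth_da (fold_smooth (hφ j) l) x).hasFDerivAt).const_mul (w j)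
    simp only [pd, this.fderiv]
    simp

theorem fold_sub {n : ℕ} (f g : E n → ℝ)
    (hf : ContDiff ℝ ∞ f) (hg : ContDiff ℝ ∞ g) (js : List (Fin n)) :
    js.foldr pd (fun x => f x - g x) = fun x => js.foldr pd f x - js.foldr pd g x := by
  induction js with
  | nil => rfl
  | cons a l ih =>
    rw [List.foldr_cons, ih]
    funext x
    simp only [List.foldr_cons]
    have := ((smooth_da (fold_smooth hf l) x).hasFDerivAt).fun_sub
      ((smooth_da (fold_smooth hg l) x).hasFDerivAt)
    simp only [pd, this.fderiv]
    simp

theorem fold_scale {n : ℕ} (f : E n → ℝ) (hf : ContDiff ℝ ∞ f) (r : ℝ) (y0 : E n)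
    (js : List (Fin n)) :
    js.foldr pd (fun x => f (r • (x - y0))) =
      fun x => r ^ js.length * js.foldr pd f (r • (x - y0)) := by
  induction js with
  | nil => simp
  | cons a l ih =>
    rw [List.foldr_cons, ih]
    funext x
    simp only [List.foldr_cons]
    have h1 : HasFDerivAt (fun x : E n => r • (x - y0)) (r • ContinuousLinearMap.id ℝ (E n)) x :=
      ((hasFDerivAt_id x).sub_const y0).const_smul r
    have := (((smooth_da (fold_smooth hf l) (r • (x - y0))).hasFDerivAt).comp x h1).const_mul
      (r ^ l.length)
    simp only [Function.comp_def] at this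
    simp only [pd, this.fderiv]
    simp [pow_succ]
    ring

theorem natBasis_smooth {n : ℕ} (j : BIdx n) : ContDiff ℝ ∞ (natBasis j) := by
  rcases j with _ | i | s
  · exact contDiff_const
  · change ContDiff ℝ ∞ (fun x : E n => x i)
    fun_prop
  · induction s using Sym2.ind with
    | _ i j =>
      change ContDiff ℝ ∞ (fun x : E n => (if i = j then (1:ℝ)/2 else 1) * (x i * x j))
      fun_prop

theorem evalP_smooth {n : ℕ} (w : BIdx n → ℝ) : ContDiff ℝ ∞ (evalP w) := by
  unfold evalP
  apply ContDiff.sum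
  intro j _
  exact contDiff_const.mul (natBasis_smooth j)

theorem quadModel_smooth {n : ℕ} (c : ℝ) (g : Fin n → ℝ) (H : Matrix (Fin n) (Fin n) ℝ)
    (y0 : E n) : ContDiff ℝ ∞ (quadModel c g H y0) := by
  unfold quadModel
  fun_prop

theorem pd_pd {n : ℕ} {f : E n → ℝ} {x : E n} (hf : ContDiffAt ℝ 2 f x) (i j : Fin n) :
    pd i (pd j f) x =
      fderiv ℝ (fderiv ℝ f) x (EuclideanSpace.single i 1) (EuclideanSpace.single j 1) := by
  have h : DifferentiableAt ℝ (fderiv ℝ f) x :=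
    (hf.fderiv_right (m := 1) (by norm_num)).differentiableAt (by simp)
  unfold pd
  rw [fderiv_clm_apply h (by fun_prop)]
  simp

theorem specNorm_nonneg' {ι : Type*} [Fintype ι] [DecidableEq ι] (M : Matrix ι ι ℝ) :
    0 ≤ specNorm M := norm_nonneg _

theorem specNorm_sub_le {ι : Type*} [Fintype ι] [DecidableEq ι] (M N : Matrix ι ι ℝ) :
    specNorm (M - N) ≤ specNorm M + specNorm N := by
  unfold specNorm
  rw [map_sub]
  exact norm_sub_le _ _

theorem specNorm_mulVec {ι : Type*} [Fintype ι] [DecidableEq ι] (M : Matrix ι ι ℝ) (v : ι → ℝ) :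
    ‖WithLp.toLp 2 (M.mulVec v)‖ ≤ specNorm M * ‖WithLp.toLp 2 v‖ := by
  have := (Matrix.toEuclideanCLM (𝕜 := ℝ) M).le_opNorm (WithLp.toLp 2 v)
  simpa [specNorm] using this

theorem specNorm_bilin {ι : Type*} [Fintype ι] [DecidableEq ι] (M : Matrix ι ι ℝ)
    (u v : EuclideanSpace ℝ ι) :
    |∑ i, ∑ j, u i * M i j * v j| ≤ specNorm M * ‖u‖ * ‖v‖ := by
  have h1 : ∑ i, ∑ j, u i * M i j * v j = inner ℝ u (WithLp.toLp 2 (M.mulVec v.ofLp)) := by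
    simp [PiLp.inner_apply, Matrix.mulVec, dotProduct, Finset.sum_mul]
    refine Finset.sum_congr rfl fun i _ => Finset.sum_congr rfl fun j _ => by ring
  rw [h1]
  have h2 := abs_real_inner_le_norm u (WithLp.toLp 2 (M.mulVec v.ofLp))
  have h3 := specNorm_mulVec M v.ofLp
  have h4 := mul_le_mul_of_nonneg_left h3 (norm_nonneg u)
  simp only [WithLp.toLp_ofLp] at h4
  linarith

theorem specNorm_le_frob {ι : Type*} [Fintype ι] [DecidableEq ι] (M : Matrix ι ι ℝ) :
    specNorm M ≤ Real.sqrt (∑ i, ∑ j, M i j ^ 2) := by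
  apply ContinuousLinearMap.opNorm_le_bound _ (Real.sqrt_nonneg _)
  intro x
  rw [EuclideanSpace.norm_eq, EuclideanSpace.norm_eq, ← Real.sqrt_mul (by positivity)]
  apply Real.sqrt_le_sqrt
  rw [Finset.sum_mul]
  apply Finset.sum_le_sum
  intro i _
  have := Finset.sum_mul_sq_le_sq_mul_sq Finset.univ (M i) x.ofLp
  simpa [Matrix.mulVec, dotProduct] using this

theorem sum_sym2 {n : ℕ} (w : Sym2 (Fin n) → ℝ) :
    ∑ i, ∑ j, w s(i, j) ^ 2 ≤ 2 * ∑ s, w s ^ 2 := by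
  rw [← Fintype.sum_prod_type' (f := fun i j => w s(i,j)^2),
    ← Finset.sum_fiberwise (s := Finset.univ) (g := fun p : Fin n × Fin n => s(p.1, p.2)), Finset.mul_sum]
  apply Finset.sum_le_sum
  intro s _
  have : ∑ p : Fin n × Fin n with s(p.1, p.2) = s, w s(p.1, p.2) ^ 2
      = ∑ p : Fin n × Fin n with s(p.1, p.2) = s, w s ^ 2 := by
    apply Finset.sum_congr rfl
    intro p hp
    rw [(Finset.mem_filter.1 hp).2]
  rw [this, Finset.sum_const, nsmul_eq_mul]
  apply mul_le_mul_of_nonneg_right _ (sq_nonneg _)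
  induction s using Sym2.ind with
  | _ a b =>
    have : (Finset.univ.filter fun p : Fin n × Fin n => s(p.1, p.2) = s(a, b)) ⊆ {(a,b),(b,a)} := by
      intro p hp
      have := (Finset.mem_filter.1 hp).2
      rw [Sym2.eq_iff] at this
      simp only [Finset.mem_insert, Finset.mem_singleton, Prod.ext_iff]
      exact this
    exact_mod_cast (Finset.card_le_card this).trans Finset.card_le_two

theorem euc_expand {n : ℕ} (x : E n) : x = ∑ i, x i • (EuclideanSpace.single i (1:ℝ) : E n) := by
  have := (EuclideanSpace.basisFun (Fin n) ℝ).sum_repr x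
  simpa [EuclideanSpace.basisFun_apply] using this.symm

theorem lin_expand {n : ℕ} (l : E n →L[ℝ] ℝ) (x : E n) :
    l x = ∑ i, l (EuclideanSpace.single i 1) * x i := by
  conv_lhs => rw [euc_expand x]
  rw [map_sum]
  refine Finset.sum_congr rfl fun i _ => ?_
  rw [map_smul, smul_eq_mul, mul_comm]

theorem bilin_expand {n : ℕ} (B : E n →L[ℝ] E n →L[ℝ] ℝ) (x z : E n) :
    B x z = ∑ i, ∑ j, x i * B (EuclideanSpace.single i 1) (EuclideanSpace.single j 1) * z j := by
  conv_lhs => rw [euc_expand x]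
  rw [map_sum, sum_apply]
  refine Finset.sum_congr rfl fun i _ => ?_
  rw [map_smul, smul_apply, smul_eq_mul, lin_expand _ z, Finset.mul_sum]
  refine Finset.sum_congr rfl fun j _ => by ring

theorem hess_norm {n : ℕ} (f : E n → ℝ) (x z : E n) :
    ‖fderiv ℝ (fderiv ℝ f) x - fderiv ℝ (fderiv ℝ f) z‖ ≤ specNorm (hessMat f x - hessMat f z) := by
  apply ContinuousLinearMap.opNorm_le_bound₂ _ (specNorm_nonneg' _)
  intro u v
  rw [bilin_expand, Real.norm_eq_abs]
  exact specNorm_bilin _ u v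

theorem grad_norm {n : ℕ} (l : E n →L[ℝ] ℝ) :
    ‖(WithLp.toLp 2 (fun i => l (EuclideanSpace.single i 1)) : E n)‖ ≤ ‖l‖ := by
  set v : E n := WithLp.toLp 2 (fun i => l (EuclideanSpace.single i 1)) with hv
  have h1 : l v = ‖v‖ ^ 2 := by
    rw [lin_expand, EuclideanSpace.norm_sq_eq]
    refine Finset.sum_congr rfl fun i _ => ?_
    simp [hv, pow_two]
  have h2 := l.le_opNorm v
  rw [h1, Real.norm_eq_abs, abs_of_nonneg (by positivity), pow_two] at h2
  rcases (norm_nonneg v).eq_or_lt with h | h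
  · rw [← h]; positivity
  · exact le_of_mul_le_mul_right h2 h

/-- second order Taylor polynomial -/
def tay {n : ℕ} (f : E n → ℝ) (y0 : E n) : E n → ℝ :=
  quadModel (f y0) (gradVec f y0) (hessMat f y0) y0

theorem tay_eq {n : ℕ} (f : E n → ℝ) (y0 x : E n) :
    tay f y0 x = f y0 + fderiv ℝ f y0 (x - y0) +
      (1/2) * fderiv ℝ (fderiv ℝ f) y0 (x - y0) (x - y0) := by
  rw [lin_expand, bilin_expand]
  rfl

theorem tay_deriv {n : ℕ} {f : E n → ℝ} {y0 : E n} (hf : ContDiffAt ℝ 2 f y0) (x : E n) :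
    HasFDerivAt (tay f y0) (fderiv ℝ f y0 + fderiv ℝ (fderiv ℝ f) y0 (x - y0)) x := by
  have hs : IsSymmSndFDerivAt ℝ f y0 := hf.isSymmSndFDerivAt (by simp)
  have h0 : HasFDerivAt (fun x : E n => x - y0) (ContinuousLinearMap.id ℝ (E n)) x :=
    (hasFDerivAt_id x).sub_const y0
  have h1 := ((fderiv ℝ f y0).hasFDerivAt (x := x - y0)).comp x h0
  have h2 := (((fderiv ℝ (fderiv ℝ f) y0).hasFDerivAt (x := x - y0)).comp x h0).clm_apply h0
  have h3 := (h1.const_add (f y0)).add (h2.const_mul (1/2))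
  have h4 : tay f y0 = (fun x => f y0 + (⇑(fderiv ℝ f y0) ∘ fun x => x - y0) x) + fun y =>
      1 / 2 * ((⇑(fderiv ℝ (fderiv ℝ f) y0) ∘ fun x => x - y0) y) (y - y0) := by
    funext x
    rw [tay_eq]
    rfl
  rw [h4]
  refine h3.congr_fderiv ?_
  ext u
  have := hs u (x - y0)
  simp only [add_apply, smul_apply, ContinuousLinearMap.comp_apply, ContinuousLinearMap.id_apply,
    ContinuousLinearMap.flip_apply, Function.comp_apply, smul_eq_mul, this]
  ring

theorem tay_deriv2 {n : ℕ} {f : E n → ℝ} {y0 : E n} (hf : ContDiffAt ℝ 2 f y0) (x : E n) :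
    fderiv ℝ (fderiv ℝ (tay f y0)) x = fderiv ℝ (fderiv ℝ f) y0 := by
  have h : fderiv ℝ (tay f y0) = fun x => fderiv ℝ f y0 + fderiv ℝ (fderiv ℝ f) y0 (x - y0) := by
    funext x
    exact (tay_deriv hf x).fderiv
  rw [h]
  have h0 : HasFDerivAt (fun x : E n => x - y0) (ContinuousLinearMap.id ℝ (E n)) x :=
    (hasFDerivAt_id x).sub_const y0
  have h1 := (((fderiv ℝ (fderiv ℝ f) y0).hasFDerivAt (x := x - y0)).comp x h0).const_add
    (fderiv ℝ f y0)
  simp only [Function.comp_def] at h1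
  rw [h1.fderiv]
  simp

theorem tay_grad_bound {n : ℕ} {f : E n → ℝ} {U : Set (E n)} (hU : IsOpen U)
    (hf : ContDiffOn ℝ 2 f U) {y0 : E n} {L : ℝ} (hL : 0 ≤ L)
    (hLip : ∀ z ∈ U, ‖fderiv ℝ (fderiv ℝ f) z - fderiv ℝ (fderiv ℝ f) y0‖ ≤ L * ‖z - y0‖)
    (x : E n) (hx : closedBall y0 ‖x - y0‖ ⊆ U) :
    ‖fderiv ℝ f x - fderiv ℝ (tay f y0) x‖ ≤ L * ‖x - y0‖ ^ 2 := by
  have hy0 : y0 ∈ closedBall y0 ‖x - y0‖ := mem_closedBall_self (norm_nonneg _)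
  have hxm : x ∈ closedBall y0 ‖x - y0‖ := by rw [mem_closedBall_iff_norm]
  have hd : ∀ z ∈ U, ContDiffAt ℝ 2 f z := fun z hz => hf.contDiffAt (hU.mem_nhds hz)
  have := Convex.norm_image_sub_le_of_norm_fderiv_le' (𝕜 := ℝ) (f := fderiv ℝ f)
    (s := closedBall y0 ‖x - y0‖) (φ := fderiv ℝ (fderiv ℝ f) y0) (C := L * ‖x - y0‖)
    (fun z hz => ((hd z (hx hz)).fderiv_right (m := 1) (by norm_num)).differentiableAt (by simp))
    (fun z hz => (hLip z (hx hz)).trans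
      (mul_le_mul_of_nonneg_left (mem_closedBall_iff_norm.1 hz) hL))
    (convex_closedBall _ _) hy0 hxm
  rw [(tay_deriv (hd y0 (hx hy0)) x).fderiv, ← sub_sub]
  calc _ ≤ _ := this
    _ = _ := by ring

theorem tay_val_bound {n : ℕ} {f : E n → ℝ} {U : Set (E n)} (hU : IsOpen U)
    (hf : ContDiffOn ℝ 2 f U) {y0 : E n} {L : ℝ} (hL : 0 ≤ L)
    (hLip : ∀ z ∈ U, ‖fderiv ℝ (fderiv ℝ f) z - fderiv ℝ (fderiv ℝ f) y0‖ ≤ L * ‖z - y0‖)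
    (x : E n) (hx : closedBall y0 ‖x - y0‖ ⊆ U) :
    |f x - tay f y0 x| ≤ L * ‖x - y0‖ ^ 3 := by
  have hy0 : y0 ∈ closedBall y0 ‖x - y0‖ := mem_closedBall_self (norm_nonneg _)
  have hxm : x ∈ closedBall y0 ‖x - y0‖ := by rw [mem_closedBall_iff_norm]
  have hd : ∀ z ∈ U, ContDiffAt ℝ 2 f z := fun z hz => hf.contDiffAt (hU.mem_nhds hz)
  have hda : ∀ z ∈ closedBall y0 ‖x - y0‖, HasFDerivAt (fun z => f z - tay f y0 z)
      (fderiv ℝ f z - fderiv ℝ (tay f y0) z) z := by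
    intro z hz
    exact ((hd z (hx hz)).differentiableAt (by simp)).hasFDerivAt.fun_sub
      (tay_deriv (hd y0 (hx hy0)) z).differentiableAt.hasFDerivAt
  have := Convex.norm_image_sub_le_of_norm_hasFDerivWithin_le (𝕜 := ℝ)
    (f := fun z => f z - tay f y0 z) (s := closedBall y0 ‖x - y0‖) (C := L * ‖x - y0‖ ^ 2)
    (fun z hz => (hda z hz).hasFDerivWithinAt)
    (fun z hz => by
      have hz' := mem_closedBall_iff_norm.1 hz
      refine (tay_grad_bound hU hf hL hLip z ((closedBall_subset_closedBall hz').trans hx)).trans ?_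
      gcongr)
    (convex_closedBall _ _) hy0 hxm
  have h0 : tay f y0 y0 = f y0 := by rw [tay_eq]; simp
  rw [h0, sub_self, sub_zero, Real.norm_eq_abs] at this
  calc _ ≤ _ := this
    _ = _ := by ring

theorem tay_fold_bound {n : ℕ} {f : E n → ℝ} {U : Set (E n)} (hU : IsOpen U)
    (hf : ContDiffOn ℝ 2 f U) {y0 : E n} {L : ℝ} (hL : 0 ≤ L)
    (hLip : ∀ z ∈ U, ‖fderiv ℝ (fderiv ℝ f) z - fderiv ℝ (fderiv ℝ f) y0‖ ≤ L * ‖z - y0‖)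
    (x : E n) (r : ℝ) (hxr : ‖x - y0‖ ≤ r) (hx : closedBall y0 r ⊆ U)
    (js : List (Fin n)) (hjs : js.length ≤ 2) :
    r ^ js.length * |js.foldr pd f x - js.foldr pd (tay f y0) x| ≤ L * r ^ 3 := by
  have hr : 0 ≤ r := (norm_nonneg _).trans hxr
  have hx' := (closedBall_subset_closedBall hxr).trans hx
  have hxU : x ∈ U := hx (mem_closedBall_iff_norm.2 hxr)
  have hy0 : y0 ∈ U := hx (mem_closedBall_self hr)
  have hd : ∀ z ∈ U, ContDiffAt ℝ 2 f z := fun z hz => hf.contDiffAt (hU.mem_nhds hz)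
  have e1 : ∀ i : Fin n, ‖(EuclideanSpace.single i (1:ℝ) : E n)‖ = 1 := by intro i; simp
  match js, hjs with
  | [], _ =>
    have := tay_val_bound hU hf hL hLip x hx'
    have h3 : L * ‖x - y0‖ ^ 3 ≤ L * r ^ 3 := by gcongr
    simpa using this.trans h3
  | [i], _ =>
    have := tay_grad_bound hU hf hL hLip x hx'
    have h3 : L * ‖x - y0‖ ^ 2 ≤ L * r ^ 2 := by gcongr
    have h4 := (fderiv ℝ f x - fderiv ℝ (tay f y0) x).le_opNorm (EuclideanSpace.single i 1)
    rw [e1, mul_one, Real.norm_eq_abs] at h4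
    have h5 := mul_le_mul_of_nonneg_left (h4.trans (this.trans h3)) hr
    simp only [List.length_singleton, pow_one, List.foldr_cons, List.foldr_nil, pd]
    calc _ ≤ _ := h5
      _ = _ := by ring
  | [i, j], _ =>
    have h1 := hLip x hxU
    have hT : ContDiffAt ℝ 2 (tay f y0) x :=
      (contDiff_infty.1 (quadModel_smooth _ _ _ _) 2).contDiffAt
    have h3 : L * ‖x - y0‖ ≤ L * r := by gcongr
    have h4 := (fderiv ℝ (fderiv ℝ f) x - fderiv ℝ (fderiv ℝ f) y0).le_opNorm₂
      (EuclideanSpace.single i 1) (EuclideanSpace.single j 1)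
    rw [e1, e1, mul_one, mul_one, Real.norm_eq_abs] at h4
    have h5 := mul_le_mul_of_nonneg_left (h4.trans (h1.trans h3)) (sq_nonneg r)
    simp only [List.length_cons, List.length_nil, List.foldr_cons, List.foldr_nil]
    rw [pd_pd (hd x hxU), pd_pd hT,
      tay_deriv2 (hd y0 hy0)]
    calc _ ≤ _ := h5
      _ = _ := by ring

/-- scaled coefficient vector -/
def coefV {n : ℕ} (c : ℝ) (g : Fin n → ℝ) (H : Matrix (Fin n) (Fin n) ℝ) (hH : H.IsSymm)
    (r : ℝ) : BIdx n → ℝ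
  | Sum.inl _ => c
  | Sum.inr (Sum.inl i) => r * g i
  | Sum.inr (Sum.inr s) => Sym2.lift ⟨fun i j => r ^ 2 * H i j, fun i j => congrArg (fun t => r ^ 2 * t) (hH.apply j i)⟩ s

theorem coefV_eval {n : ℕ} (c : ℝ) (g : Fin n → ℝ) (H : Matrix (Fin n) (Fin n) ℝ)
    (hH : H.IsSymm) (r : ℝ) (hr : r ≠ 0) (y0 : E n) :
    quadModel c g H y0 = fun x => evalP (coefV c g H hH r) (r⁻¹ • (x - y0)) := by
  funext x
  simp only [evalP, quadModel, Fintype.sum_sum_type]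
  have h1 : ∑ i, coefV c g H hH r (Sum.inr (Sum.inl i)) *
      natBasis (Sum.inr (Sum.inl i)) (r⁻¹ • (x - y0)) = ∑ i, g i * (x i - y0 i) := by
    refine Finset.sum_congr rfl fun i _ => ?_
    simp [coefV, natBasis]
    field_simp
  have h2 : (1 / 2) * ∑ i, ∑ j, (x i - y0 i) * H i j * (x j - y0 j) =
      ∑ s, coefV c g H hH r (Sum.inr (Sum.inr s)) *
        natBasis (Sum.inr (Sum.inr s)) (r⁻¹ • (x - y0)) := by
    rw [← Fintype.sum_prod_type' (f := fun i j => (x i - y0 i) * H i j * (x j - y0 j)),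
      ← Finset.sum_fiberwise (s := Finset.univ) (g := fun p : Fin n × Fin n => s(p.1, p.2)),
      Finset.mul_sum]
    refine Finset.sum_congr rfl fun s _ => ?_
    induction s using Sym2.ind with
    | _ a b =>
      have : (Finset.univ.filter fun p : Fin n × Fin n => s(p.1, p.2) = s(a, b))
          = {(a,b),(b,a)} := by
        ext p
        simp only [Finset.mem_filter, Finset.mem_univ, true_and, Sym2.eq_iff, Finset.mem_insert,
          Finset.mem_singleton, Prod.ext_iff]
      rw [this]
      by_cases hab : a = b
      · subst hab
        simp [coefV, natBasis]
        field_simp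
      · rw [Finset.sum_pair (by simp [hab])]
        simp [coefV, natBasis, hab, hH.apply a b]
        field_simp
        ring
  rw [h1, h2]
  simp [coefV, natBasis]
  ring

theorem norm_coefV {n : ℕ} (w : BIdx n → ℝ) :
    ‖(WithLp.toLp 2 w : EuclideanSpace ℝ (BIdx n))‖ ^ 2 =
      w (Sum.inl ()) ^ 2 + (∑ i, w (Sum.inr (Sum.inl i)) ^ 2 + ∑ s, w (Sum.inr (Sum.inr s)) ^ 2) := by
  rw [EuclideanSpace.norm_sq_eq]
  simp [Fintype.sum_sum_type]

theorem coefV_bounds {n : ℕ} (c : ℝ) (g : Fin n → ℝ) (H : Matrix (Fin n) (Fin n) ℝ)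
    (hH : H.IsSymm) (r : ℝ) (hr : 0 < r) (b : ℝ)
    (hb : ‖(WithLp.toLp 2 (coefV c g H hH r) : EuclideanSpace ℝ (BIdx n))‖ ≤ b) :
    |c| ≤ b ∧ r * ‖(WithLp.toLp 2 g : E n)‖ ≤ b ∧ r ^ 2 * specNorm H ≤ Real.sqrt 2 * b := by
  have hb0 : 0 ≤ b := (norm_nonneg _).trans hb
  have h := pow_le_pow_left₀ (norm_nonneg _) hb 2
  rw [norm_coefV] at h
  set S2 := ∑ s, coefV c g H hH r (Sum.inr (Sum.inr s)) ^ 2 with hS2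
  have hS2' : 0 ≤ S2 := Finset.sum_nonneg fun _ _ => sq_nonneg _
  have h1 : ∑ i, coefV c g H hH r (Sum.inr (Sum.inl i)) ^ 2
      = (r * ‖(WithLp.toLp 2 g : E n)‖) ^ 2 := by
    rw [mul_pow, EuclideanSpace.norm_sq_eq, Finset.mul_sum]
    refine Finset.sum_congr rfl fun i _ => ?_
    simp [coefV, mul_pow]
  have h2 : coefV c g H hH r (Sum.inl ()) = c := rfl
  rw [h1, h2] at h
  refine ⟨abs_le_of_sq_le_sq (by nlinarith [sq_nonneg (r * ‖(WithLp.toLp 2 g : E n)‖)]) hb0,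
    (sq_le_sq₀ (by positivity) hb0).1 ?_, ?_⟩
  · nlinarith [sq_nonneg c]
  · have h3 := sum_sym2 (fun s => coefV c g H hH r (Sum.inr (Sum.inr s)))
    have h4 : ∑ i, ∑ j, coefV c g H hH r (Sum.inr (Sum.inr s(i, j))) ^ 2
        = (r ^ 2) ^ 2 * ∑ i, ∑ j, H i j ^ 2 := by
      simp only [Finset.mul_sum]
      refine Finset.sum_congr rfl fun i _ => Finset.sum_congr rfl fun j _ => ?_
      simp [coefV]
      ring
    rw [h4] at h3
    have h5 := mul_le_mul_of_nonneg_left (specNorm_le_frob H) (sq_nonneg r)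
    refine h5.trans ?_
    refine (sq_le_sq₀ (by positivity) (by positivity)).1 ?_
    rw [mul_pow, mul_pow, Real.sq_sqrt (by positivity), Real.sq_sqrt (by positivity)]
    nlinarith [sq_nonneg c, sq_nonneg (r * ‖(WithLp.toLp 2 g : E n)‖)]

theorem mpd_zero {n : ℕ} (f : E n → ℝ) : mpd (fun _ => 0) f = f := by
  obtain ⟨js, h1, h2⟩ := mpd_list (n := n) (fun _ => 0)
  have : js = [] := List.length_eq_zero_iff.1 (by simpa [mdeg] using h1)
  rw [h2, this]
  rfl

theorem inv_specNorm_ge {n : ℕ} (y : BIdx n → E n) (α : BIdx n → Fin n → ℕ)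
    (h0 : α (Sum.inl ()) = fun _ => 0) (hpoised : IsUnit (Mhat y α)) :
    1 ≤ specNorm (Mhat y α)⁻¹ := by
  have hrow : ∀ j, Mhat y α (Sum.inl ()) j = if j = Sum.inl () then 1 else 0 := by
    intro j
    have hy : yhat y (Sum.inl ()) = 0 := by simp [yhat, center]
    simp only [Mhat, Matrix.of_apply, h0, mpd_zero, hy]
    rcases j with _ | i | s
    · simp [natBasis]
    · simp [natBasis]
    · induction s using Sym2.ind with
      | _ a b => simp [natBasis]
  have h1 : (Mhat y α * (Mhat y α)⁻¹) (Sum.inl ()) (Sum.inl ()) = 1 := by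
    rw [Matrix.mul_nonsing_inv _ ((Matrix.isUnit_iff_isUnit_det _).1 hpoised)]
    simp
  rw [Matrix.mul_apply] at h1
  simp only [hrow, ite_mul, one_mul, zero_mul, Finset.sum_ite_eq', Finset.mem_univ, if_true] at h1
  have h2 := specNorm_bilin (Mhat y α)⁻¹ (EuclideanSpace.single (Sum.inl ()) 1)
    (EuclideanSpace.single (Sum.inl ()) 1)
  simp [h1] at h2
  exact h2

theorem card_count {n : ℕ} (α : BIdx n → Fin n → ℕ) (hα : ∀ i, mdeg (α i) ≤ 2) :
    (ncount α 0 : ℝ) + ncount α 1 + ncount α 2 = Fintype.card (BIdx n) := by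
  have := Finset.card_eq_sum_card_fiberwise (s := (Finset.univ : Finset (BIdx n)))
    (f := fun i => mdeg (α i)) (t := Finset.range 3)
    (fun i _ => by have := hα i; simp; omega)
  simp only [Finset.sum_range_succ, Finset.sum_range_zero, zero_add] at this
  rw [← Finset.card_univ, this]
  push_cast
  rfl

theorem kfac_ge {n : ℕ} (α : BIdx n → Fin n → ℕ) (hα : ∀ i, mdeg (α i) ≤ 2) :
    3 / 2 * Real.sqrt (Fintype.card (BIdx n)) ≤ kfac α := by
  have h : (3:ℝ) / 2 = Real.sqrt (9/4) := by
    rw [show (9:ℝ)/4 = (3/2)^2 by norm_num, Real.sqrt_sq (by norm_num)]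
  rw [h, ← Real.sqrt_mul (by norm_num), ← card_count α hα, kfac]
  apply Real.sqrt_le_sqrt
  have h1 : (0:ℝ) ≤ ncount α 1 := by positivity
  have h2 : (0:ℝ) ≤ ncount α 2 := by positivity
  linarith

theorem sqrt_card_ge {n : ℕ} (hn : 1 ≤ n) : (1.7:ℝ) ≤ Real.sqrt (Fintype.card (BIdx n)) := by
  apply Real.le_sqrt_of_sq_le
  have h1 : 1 ≤ Fintype.card (Sym2 (Fin n)) :=
    Fintype.card_pos_iff.2 ⟨s(⟨0, hn⟩, ⟨0, hn⟩)⟩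
  have : 3 ≤ Fintype.card (BIdx n) := by
    simp only [Fintype.card_sum, Fintype.card_fin, Fintype.card_unit]
    omega
  have h3 : (3:ℝ) ≤ Fintype.card (BIdx n) := by exact_mod_cast this
  norm_num at h3 ⊢
  linarith

theorem quadModel_sub {n : ℕ} (c c' : ℝ) (g g' : Fin n → ℝ) (H H' : Matrix (Fin n) (Fin n) ℝ)
    (y0 x : E n) : quadModel c g H y0 x - quadModel c' g' H' y0 x =
      quadModel (c - c') (g - g') (H - H') y0 x := by
  simp only [quadModel, Pi.sub_apply, Matrix.sub_apply, sub_mul, mul_sub, Finset.sum_sub_distrib]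
  ring

theorem norm_le_of_residual {n : ℕ} (y : BIdx n → E n) (α : BIdx n → Fin n → ℕ)
    (hpoised : IsUnit (Mhat y α)) (w : BIdx n → ℝ) (K b : ℝ) (hb : 0 ≤ b)
    (hK : specNorm (Mhat y α)⁻¹ ≤ K)
    (hres : ∀ i, |mpd (α i) (evalP w) (yhat y i)| ≤ b) :
    ‖(WithLp.toLp 2 w : EuclideanSpace ℝ (BIdx n))‖ ≤
      K * (Real.sqrt (Fintype.card (BIdx n)) * b) := by
  have h1 : ∀ i, (Mhat y α).mulVec w i = mpd (α i) (evalP w) (yhat y i) := by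
    intro i
    obtain ⟨js, -, h2⟩ := mpd_list (α i)
    have : js.foldr pd (evalP w) (yhat y i) = _ := congrFun (fold_sum natBasis natBasis_smooth w js) _
    rw [h2, this]
    simp only [Matrix.mulVec, dotProduct, Mhat, Matrix.of_apply, h2]
    exact Finset.sum_congr rfl fun j _ => mul_comm _ _
  have h2 := specNorm_mulVec (Mhat y α)⁻¹ ((Mhat y α).mulVec w)
  rw [Matrix.mulVec_mulVec,
    Matrix.nonsing_inv_mul _ ((Matrix.isUnit_iff_isUnit_det _).1 hpoised), Matrix.one_mulVec] at h2
  have h3 : ‖(WithLp.toLp 2 ((Mhat y α).mulVec w) : EuclideanSpace ℝ (BIdx n))‖ ≤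
      Real.sqrt (Fintype.card (BIdx n)) * b := by
    rw [EuclideanSpace.norm_eq]
    apply Real.sqrt_le_iff.2 ⟨by positivity, ?_⟩
    rw [mul_pow, Real.sq_sqrt (by positivity)]
    have : ∀ i ∈ (Finset.univ : Finset (BIdx n)), ‖(Mhat y α).mulVec w i‖ ^ 2 ≤ b ^ 2 := by
      intro i _
      rw [h1, Real.norm_eq_abs]
      exact pow_le_pow_left₀ (abs_nonneg _) (hres i) 2
    have := Finset.sum_le_card_nsmul _ _ _ this
    simpa using this
  refine h2.trans (mul_le_mul hK h3 (norm_nonneg _) ((specNorm_nonneg' _).trans hK))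

/-- the Birkhoff interpolant of a `Λ`-poised data set is a fully quadratic
model, with constants expressed through `C Λ`. -/
theorem fully_quadratic_of_lambda_poised {n : ℕ} (hn : 1 ≤ n)
    (y : BIdx n → E n) (α : BIdx n → Fin n → ℕ)
    (A : Finset (Fin n → ℕ)) (h0A : (fun _ => 0) ∈ A) (hA : ∀ a ∈ A, mdeg a ≤ 2)
    (hαA : ∀ i, α i ∈ A)
    (h0 : α (Sum.inl ()) = fun _ => 0)
    (hrad : 0 < rad y) (hpoised : IsUnit (Mhat y α))
    (Δ : ℝ) (hΔ : rad y ≤ Δ)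
    (v : BIdx n → BIdx n → ℝ) (hv : BirkhoffLam y α v)
    (Λ C : ℝ)
    (hΛ : ∀ i : BIdx n, ∀ a ∈ A, ∀ x ∈ closedBall (center y) (rad y),
      |mpd a (evalP (v i)) ((rad y)⁻¹ • (x - center y))| ≤ Λ)
    (hC : specNorm (Mhat y α)⁻¹ ≤ C * Λ)
    (f : E n → ℝ) (U : Set (E n)) (hU : IsOpen U)
    (hUball : closedBall (center y) (2 * Δ) ⊆ U)
    (hf : ContDiffOn ℝ 2 f U) (L : ℝ)
    (hLip : ∀ w ∈ U, ∀ z ∈ U, specNorm (hessMat f z - hessMat f w) ≤ L * ‖z - w‖)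
    (c : ℝ) (g : Fin n → ℝ) (H : Matrix (Fin n) (Fin n) ℝ) (hH : H.IsSymm)
    (hinterp : ∀ i, mpd (α i) (quadModel c g H (center y)) (y i) = mpd (α i) f (y i)) :
    ∀ z ∈ closedBall (center y) Δ,
      specNorm (H - hessMat f z) ≤ Real.sqrt 2 * kfac α * L * (C * Λ) * Δ ∧
      Real.sqrt (∑ i, (g i + (∑ j, H i j * (z j - center y j)) - gradVec f z i) ^ 2)
        ≤ (1 + Real.sqrt 2) * kfac α * L * (C * Λ) * Δ ^ 2 ∧
      |quadModel c g H (center y) z - f z|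
        ≤ (4 / 3 + 2 * (1 + 2 * Real.sqrt 2) * kfac α * (C * Λ)) * L * Δ ^ 3 := by
  set y0 := center y with hy0
  set r := rad y with hr
  have hΔ0 : 0 < Δ := hrad.trans_le hΔ
  have hα : ∀ i, mdeg (α i) ≤ 2 := fun i => hA _ (hαA i)
  have hball : closedBall y0 Δ ⊆ U :=
    (closedBall_subset_closedBall (by linarith)).trans hUball
  have hy0U : y0 ∈ U := hball (mem_closedBall_self hΔ0.le)
  have hcd : ContDiffAt ℝ 2 f y0 := hf.contDiffAt (hU.mem_nhds hy0U)
  have hL : 0 ≤ L := by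
    let e : E n := EuclideanSpace.single ⟨0, hn⟩ Δ
    have he : ‖e‖ = Δ := by simp [e, abs_of_pos hΔ0]
    have hm : y0 + e ∈ U := hball (by simp [he])
    have h1 := (specNorm_nonneg' _).trans (hLip y0 hy0U (y0 + e) hm)
    rw [add_sub_cancel_left, he] at h1
    exact nonneg_of_mul_nonneg_left h1 hΔ0
  have hLip' : ∀ z ∈ U, ‖fderiv ℝ (fderiv ℝ f) z - fderiv ℝ (fderiv ℝ f) y0‖ ≤ L * ‖z - y0‖ :=
    fun z hz => (hess_norm f z y0).trans (hLip y0 hy0U z hz)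
  have hsym : (hessMat f y0).IsSymm := by
    have hs : IsSymmSndFDerivAt ℝ f y0 := hcd.isSymmSndFDerivAt (by simp)
    ext i j
    simp only [hessMat, Matrix.transpose_apply, Matrix.of_apply]
    exact hs _ _
  have hHs : (H - hessMat f y0).IsSymm := hH.sub hsym
  set c' := c - f y0 with hc'
  set g' := g - gradVec f y0 with hg'
  set H' := H - hessMat f y0 with hH'
  have hE : quadModel c' g' H' y0 = fun x => quadModel c g H y0 x - tay f y0 x := by
    funext x
    exact (quadModel_sub _ _ _ _ _ _ _ _).symm
  have hres : ∀ i, |mpd (α i) (evalP (coefV c' g' H' hHs r)) (yhat y i)| ≤ L * r ^ 3 := by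
    intro i
    obtain ⟨js, hl, hm⟩ := mpd_list (α i)
    have hyi : ‖y i - y0‖ ≤ r :=
      Finset.le_sup' (fun i => ‖y i - center y‖) (Finset.mem_univ i)
    have hb := tay_fold_bound hU hf hL hLip' (y i) r hyi
      ((closedBall_subset_closedBall hΔ).trans hball) js (hl ▸ hα i)
    have h1 := congrFun (fold_scale (evalP (coefV c' g' H' hHs r)) (evalP_smooth _) r⁻¹ y0 js) (y i)
    rw [← coefV_eval c' g' H' hHs r hrad.ne' y0, hE,
      fold_sub _ (tay f y0) (quadModel_smooth _ _ _ _) (quadModel_smooth _ _ _ _)] at h1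
    have h2 := hinterp i
    rw [hm, hm] at h2
    simp only at h1
    rw [h2] at h1
    rw [hm]
    change js.foldr pd f (y i) - js.foldr pd (tay f y0) (y i) = r⁻¹ ^ js.length *
      js.foldr pd (evalP (coefV c' g' H' hHs r)) (yhat y i) at h1
    rw [h1, abs_mul, abs_of_pos (by positivity), ← mul_assoc, ← mul_pow,
      mul_inv_cancel₀ hrad.ne', one_pow, one_mul] at hb
    exact hb
  set K := C * Λ with hK
  have hK1 : 1 ≤ K := (inv_specNorm_ge y α h0 hpoised).trans hC
  set S := Real.sqrt (Fintype.card (BIdx n)) with hS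
  have hS1 : 1.7 ≤ S := sqrt_card_ge hn
  have hk : 3 / 2 * S ≤ kfac α := kfac_ge α hα
  set k := kfac α with hkdef
  have hw := norm_le_of_residual y α hpoised _ K (L * r ^ 3) (by positivity) hC hres
  obtain ⟨b0, b1, b2⟩ := coefV_bounds c' g' H' hHs r hrad _ hw
  have hs2 : 1.4 ≤ Real.sqrt 2 := Real.le_sqrt_of_sq_le (by norm_num)
  set s2 := Real.sqrt 2 with hs2d
  have hS0 : 0 ≤ S := by linarith
  have hK0 : 0 ≤ K := by linarith
  -- unscaled bounds
  have d0 : |c'| ≤ K * S * L * Δ ^ 3 := by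
    refine b0.trans ?_
    rw [show K * (S * (L * r ^ 3)) = K * S * L * r ^ 3 by ring]
    gcongr
  have d1 : ‖(WithLp.toLp 2 g' : E n)‖ ≤ K * S * L * Δ ^ 2 := by
    have : ‖(WithLp.toLp 2 g' : E n)‖ ≤ K * S * L * r ^ 2 := by
      refine le_of_mul_le_mul_left (b1.trans_eq ?_) hrad
      ring
    refine this.trans ?_
    gcongr
  have d2 : specNorm H' ≤ s2 * (K * S * L * Δ) := by
    have : specNorm H' ≤ s2 * (K * S * L * r) := by
      refine le_of_mul_le_mul_left (b2.trans_eq ?_) (pow_pos hrad 2)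
      ring
    refine this.trans ?_
    gcongr
  intro z hz
  have hzn : ‖z - y0‖ ≤ Δ := mem_closedBall_iff_norm.1 hz
  have hzU : z ∈ U := hball hz
  have hzb : closedBall y0 ‖z - y0‖ ⊆ U := (closedBall_subset_closedBall hzn).trans hball
  -- key scalar inequality
  have hKk : K * S + 0.85 ≤ K * k := by nlinarith
  have hT : ∀ t m : ℝ, 0 ≤ m → 0 ≤ t → 1 ≤ 0.85 * t → t * (K * S * m) + m ≤ t * (K * k * m) := by
    intro t m hm ht ht1
    have h1 := mul_le_mul_of_nonneg_left hKk (mul_nonneg ht hm)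
    nlinarith
  refine ⟨?_, ?_, ?_⟩
  · have h1 : H - hessMat f z = H' - (hessMat f z - hessMat f y0) := by rw [hH']; abel
    rw [h1]
    have h2 := hLip y0 hy0U z hzU
    have h3 : L * ‖z - y0‖ ≤ L * Δ := by gcongr
    have h4 := hT s2 (L * Δ) (by positivity) (by positivity) (by linarith)
    calc _ ≤ _ := specNorm_sub_le _ _
      _ ≤ s2 * (K * S * L * Δ) + L * Δ := by linarith
      _ = s2 * (K * S * (L * Δ)) + L * Δ := by ring
      _ ≤ _ := h4
      _ = _ := by ring
  · have h1 := tay_grad_bound hU hf hL hLip' z hzb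
    have h2 := (grad_norm (fderiv ℝ f z - fderiv ℝ (tay f y0) z)).trans h1
    set G : E n := WithLp.toLp 2 (fun i => (fderiv ℝ f z - fderiv ℝ (tay f y0) z)
      (EuclideanSpace.single i 1)) with hG
    set s : E n := z - y0 with hs
    have h3 : Real.sqrt (∑ i, (g i + (∑ j, H i j * (z j - y0 j)) - gradVec f z i) ^ 2) =
        ‖(WithLp.toLp 2 g' : E n) + WithLp.toLp 2 (H'.mulVec s.ofLp) - G‖ := by
      rw [EuclideanSpace.norm_eq]
      congr 1
      refine Finset.sum_congr rfl fun i _ => ?_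
      rw [Real.norm_eq_abs, sq_abs]
      congr 1
      have hsymE : ∑ j, hessMat f y0 i j * s j =
          fderiv ℝ (fderiv ℝ f) y0 s (EuclideanSpace.single i 1) := by
        have hs' : IsSymmSndFDerivAt ℝ f y0 := hcd.isSymmSndFDerivAt (by simp)
        rw [hs' s, lin_expand _ s]
        rfl
      have hsplit : H'.mulVec s.ofLp i = ∑ j, H i j * (z j - y0 j) -
          fderiv ℝ (fderiv ℝ f) y0 s (EuclideanSpace.single i 1) := by
        rw [← hsymE, ← Finset.sum_sub_distrib]
        simp only [Matrix.mulVec, dotProduct]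
        refine Finset.sum_congr rfl fun j _ => ?_
        rw [hH', Matrix.sub_apply, sub_mul]
        rfl
      simp only [hG, PiLp.sub_apply, PiLp.add_apply, hsplit, (tay_deriv hcd z).fderiv,
        sub_apply, add_apply, hg', Pi.sub_apply, gradVec, ← hs]
      ring
    rw [h3]
    have h4 := specNorm_mulVec H' s.ofLp
    rw [WithLp.toLp_ofLp] at h4
    have h5 : specNorm H' * ‖s‖ ≤ s2 * (K * S * L * Δ) * Δ :=
      mul_le_mul d2 hzn (norm_nonneg _) (by positivity)
    have h6 : L * ‖s‖ ^ 2 ≤ L * Δ ^ 2 := by gcongr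
    have h7 := hT (1 + s2) (L * Δ ^ 2) (by positivity) (by positivity) (by linarith)
    calc _ ≤ _ := norm_sub_le _ _
      _ ≤ _ := add_le_add_left (norm_add_le _ _) _
      _ ≤ K * S * L * Δ ^ 2 + s2 * (K * S * L * Δ) * Δ + L * Δ ^ 2 := by linarith
      _ = (1 + s2) * (K * S * (L * Δ ^ 2)) + L * Δ ^ 2 := by ring
      _ ≤ _ := h7
      _ = _ := by ring
  · have h1 := tay_val_bound hU hf hL hLip' z hzb
    have h2 := congrFun hE z
    have h3 : quadModel c g H y0 z - f z = quadModel c' g' H' y0 z - (f z - tay f y0 z) := by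
      rw [h2]; ring
    rw [h3]
    set s : E n := z - y0 with hs
    have h4 : |∑ i, g' i * (z i - y0 i)| ≤ K * S * L * Δ ^ 2 * Δ := by
      have e1 : ∑ i, g' i * (z i - y0 i) = inner ℝ s (WithLp.toLp 2 g' : E n) := by
        simp [PiLp.inner_apply, hs]
      rw [e1]
      refine (abs_real_inner_le_norm _ _).trans ?_
      rw [mul_comm]
      exact mul_le_mul d1 hzn (norm_nonneg _) (by positivity)
    have h5 : |∑ i, ∑ j, (z i - y0 i) * H' i j * (z j - y0 j)| ≤ s2 * (K * S * L * Δ) * Δ * Δ := by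
      refine (specNorm_bilin H' s s).trans ?_
      have := mul_le_mul d2 hzn (norm_nonneg _) (by positivity)
      exact mul_le_mul this hzn (norm_nonneg _) (by positivity)
    have h6 : L * ‖s‖ ^ 3 ≤ L * Δ ^ 3 := by gcongr
    have h7 : |quadModel c' g' H' y0 z| ≤ K * S * L * Δ ^ 3 + K * S * L * Δ ^ 2 * Δ +
        (1 / 2) * (s2 * (K * S * L * Δ) * Δ * Δ) := by
      unfold quadModel
      refine (abs_add_three _ _ _).trans ?_
      rw [abs_mul, abs_of_pos (by norm_num : (0:ℝ) < 1 / 2)]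
      linarith
    have hp : 0 ≤ L * Δ ^ 3 := by positivity
    have h8 := mul_le_mul_of_nonneg_left hKk (mul_nonneg (by positivity : 0 ≤ 2 + 4 * s2) hp)
    have h9 : 0 ≤ K * S * (L * Δ ^ 3) := by positivity
    have h10 : 0 ≤ s2 * (K * S * (L * Δ ^ 3)) := by positivity
    have h11 : 0 ≤ s2 * (L * Δ ^ 3) := by positivity
    calc _ ≤ _ := abs_sub _ _
      _ ≤ K * S * L * Δ ^ 3 + K * S * L * Δ ^ 2 * Δ +
        (1 / 2) * (s2 * (K * S * L * Δ) * Δ * Δ) + L * Δ ^ 3 := by linarith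
      _ = 2 * (K * S * (L * Δ ^ 3)) + (1 / 2) * (s2 * (K * S * (L * Δ ^ 3))) + L * Δ ^ 3 := by ring
      _ ≤ 4 / 3 * (L * Δ ^ 3) + (2 * (K * S * (L * Δ ^ 3)) + 4 * (s2 * (K * S * (L * Δ ^ 3))) +
          1.7 * (L * Δ ^ 3) + 3.4 * (s2 * (L * Δ ^ 3))) := by linarith
      _ = 4 / 3 * (L * Δ ^ 3) + (2 + 4 * s2) * (L * Δ ^ 3) * (K * S + 0.85) := by ring
      _ ≤ 4 / 3 * (L * Δ ^ 3) + (2 + 4 * s2) * (L * Δ ^ 3) * (K * k) := by linarith only [h8]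
      _ = _ := by ring
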